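/- arXiv:2203.10530 — 5 statements merged into one kernel-verified Lean document; each statement's English description precedes it below -/
import Mathlib

section
/- For every integer d ≥ 1 there exists a constant C_d > 0 with the following property. Let K be a field equipped with a complete multiplicative nonarchimedean norm ‖·‖ (i.e. K is a complete normed field whose norm satisfies the ultrametric inequality). Let E ≥ 1 and μ ≥ (d+1)·E be integers and let 0 < ρ₀ < 1 be a real number. Suppose given: points y⁽¹⁾,…,y⁽μ⁾ ∈ K^d with ‖y⁽ʲ⁾_i‖ ≤ 1 for all i,j; weights w⁽¹⁾,…,w⁽μ⁾ ∈ K^E with ‖w⁽ʲ⁾_k‖ ≤ 1 for all j,k; and coefficients c_{i,k,ν} ∈ K for 1 ≤ i ≤ μ, 1 ≤ k ≤ E, ν ∈ ℕ^d, with ‖c_{i,k,ν}‖ ≤ ρ₀^{|ν|} where |ν| = ν₁+⋯+ν_d. Define the μ×μ matrix M over K by M_{i,j} = Σ_{k=1}^{E} ( Σ_{ν∈ℕ^d} c_{i,k,ν} · (y⁽ʲ⁾)^ν ) · w⁽ʲ⁾_k (each inner series converges in K since its terms tend to 0), and set ρ = ρ₀ · max_{1≤j,j'≤μ, 1≤i≤d}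 ‖y⁽ʲ⁾_i − y⁽ʲ'⁾_i‖. Then ‖det M‖ ≤ ρ^{C_d · E^{−1/d} · μ^{1+1/d}}, with the convention that 0 raised to a positive power is 0. -/
open Finset Filter Topology

theorem IsUltrametricDist.norm_det_le_prod {K n : Type*} [NormedField K] [IsUltrametricDist K]
    [Fintype n] [DecidableEq n] (A : Matrix n n K) (q : n → ℝ) (hA : ∀ i j, ‖A i j‖ ≤ q i) :
    ‖A.det‖ ≤ ∏ i, q i := by
  by_cases hn : IsEmpty n
  · simp
  rw [not_isEmpty_iff] at hn
  obtain ⟨i₀⟩ := hn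
  have hq : ∀ i, 0 ≤ q i := fun i => (norm_nonneg _).trans (hA i i₀)
  rw [← Matrix.det_transpose, Matrix.det_apply]
  refine IsUltrametricDist.norm_sum_le_of_forall_le_of_nonneg (prod_nonneg fun i _ => hq i) ?_
  intro σ _
  have hsign : ‖Equiv.Perm.sign σ • ∏ i, A.transpose (σ i) i‖ = ∏ i, ‖A i (σ i)‖ := by
    rcases Int.units_eq_one_or (Equiv.Perm.sign σ) with h | h <;> simp [h, norm_prod]
  rw [hsign]
  exact prod_le_prod (fun _ _ => norm_nonneg _) fun i _ => hA i _

/-- If every row of a matrix is a finite combination of vectors from a common family, only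
injective choices of vectors contribute to the determinant. -/
theorem IsUltrametricDist.norm_det_sum_le {K n ι : Type*} [NormedField K] [IsUltrametricDist K]
    [Fintype n] [DecidableEq n] (S : Finset ι) (a : n → ι → K) (v : ι → n → K) (q : ι → ℝ)
    (hq : ∀ i s j, ‖a i s * v s j‖ ≤ q s) {B : ℝ} (hB : 0 ≤ B)
    (h : ∀ φ : n → ι, Function.Injective φ → ∏ i, q (φ i) ≤ B) :
    ‖(Matrix.of fun i j => ∑ s ∈ S, a i s * v s j).det‖ ≤ B := by
  classical
  have hexp : (Matrix.of fun i j => ∑ s ∈ S, a i s * v s j).det =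
      ∑ φ ∈ Fintype.piFinset fun _ : n => S,
        (Matrix.of fun i j => a i (φ i) * v (φ i) j).det := by
    have := (Matrix.detRowAlternating (n := n) (R := K)).toMultilinearMap.map_sum_finset
      (fun i s j => a i s * v s j) (fun _ => S)
    convert this using 1
    · change _ = Matrix.det _
      congr 1
      ext i j
      simp [Finset.sum_apply]
    · rfl
  rw [hexp]
  refine IsUltrametricDist.norm_sum_le_of_forall_le_of_nonneg hB fun φ _ => ?_
  by_cases hφ : Function.Injective φ
  · exact (norm_det_le_prod _ (fun i => q (φ i)) fun i j => hq i (φ i) j).trans (h φ hφ)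
  · obtain ⟨i, j, hij, hne⟩ : ∃ i j, φ i = φ j ∧ i ≠ j := by
      simpa [Function.Injective] using hφ
    have hdet := Matrix.det_mul_column (fun i => a i (φ i)) (Matrix.of fun i j => v (φ i) j)
    have hzero : (Matrix.of fun i j => v (φ i) j).det = 0 :=
      Matrix.det_zero_of_row_eq hne (by ext l; simp [hij])
    rw [hzero, mul_zero] at hdet
    have : (Matrix.of fun i j => a i (φ i) * v (φ i) j).det = 0 := hdet
    simpa [this] using hB

/-- Taylor expansion about `a` of a polynomial in several variables. -/
theorem sum_mul_prod_add_pow {K ι : Type*} [Field K] [Fintype ι] [DecidableEq ι]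
    (F : Finset (ι → ℕ)) (N : ℕ) (hN : ∀ ν ∈ F, ∀ l, ν l ≤ N) (c : (ι → ℕ) → K) (a z : ι → K) :
    ∑ ν ∈ F, c ν * ∏ l, (a l + z l) ^ ν l =
      ∑ κ ∈ Fintype.piFinset fun _ : ι => range (N + 1),
        (∑ ν ∈ F, c ν * ∏ l, (a l ^ (ν l - κ l) * ((ν l).choose (κ l) : K))) *
          ∏ l, z l ^ κ l := by
  simp_rw [sum_mul]
  rw [sum_comm]
  refine sum_congr rfl fun ν hν => ?_
  have hpow : ∀ l, (a l + z l) ^ ν l =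
      ∑ m ∈ range (N + 1), z l ^ m * a l ^ (ν l - m) * ((ν l).choose m : K) := by
    intro l
    rw [add_comm, add_pow]
    refine sum_subset (range_subset_range.2 (by have := hN ν hν l; omega)) fun m _ hm => ?_
    rw [Nat.choose_eq_zero_of_lt (by simpa using hm)]
    simp
  simp_rw [hpow, prod_univ_sum, mul_sum]
  refine sum_congr rfl fun κ _ => ?_
  rw [mul_assoc, ← prod_mul_distrib]
  congr 1
  exact prod_congr rfl fun l _ => by ring

theorem IsUltrametricDist.norm_taylor_coeff_le {K ι : Type*} [NormedField K]
    [IsUltrametricDist K] [Fintype ι] (F : Finset (ι → ℕ)) {t : ℝ} (ht0 : 0 ≤ t) (ht1 : t ≤ 1)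
    (c : (ι → ℕ) → K) (hc : ∀ ν, ‖c ν‖ ≤ t ^ ∑ l, ν l) (a : ι → K) (ha : ∀ l, ‖a l‖ ≤ 1)
    (κ : ι → ℕ) :
    ‖∑ ν ∈ F, c ν * ∏ l, (a l ^ (ν l - κ l) * ((ν l).choose (κ l) : K))‖ ≤ t ^ ∑ l, κ l := by
  refine IsUltrametricDist.norm_sum_le_of_forall_le_of_nonneg (by positivity) fun ν _ => ?_
  by_cases h : ∀ l, κ l ≤ ν l
  · have hprod : ‖∏ l, (a l ^ (ν l - κ l) * ((ν l).choose (κ l) : K))‖ ≤ 1 := by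
      rw [norm_prod]
      refine prod_le_one (fun _ _ => norm_nonneg _) fun l _ => ?_
      rw [norm_mul, norm_pow]
      exact mul_le_one₀ (pow_le_one₀ (norm_nonneg _) (ha l)) (norm_nonneg _)
        (IsUltrametricDist.norm_natCast_le_one K _)
    rw [norm_mul]
    calc _ ≤ t ^ (∑ l, ν l) * 1 := mul_le_mul (hc ν) hprod (norm_nonneg _) (by positivity)
      _ ≤ t ^ ∑ l, κ l := by
        rw [mul_one]
        exact pow_le_pow_of_le_one ht0 ht1 (sum_le_sum fun l _ => h l)
  · push Not at h
    obtain ⟨l, hl⟩ := h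
    rw [prod_eq_zero (mem_univ l) (by simp [Nat.choose_eq_zero_of_lt hl])]
    simpa using pow_nonneg ht0 _

theorem IsUltrametricDist.summable_mul_prod_pow {K ι : Type*} [NormedField K] [CompleteSpace K]
    [IsUltrametricDist K] [Fintype ι] {t : ℝ} (ht0 : 0 ≤ t) (ht1 : t < 1)
    (c : (ι → ℕ) → K) (hc : ∀ ν, ‖c ν‖ ≤ t ^ ∑ l, ν l) (y : ι → K) (hy : ∀ l, ‖y l‖ ≤ 1) :
    Summable fun ν : ι → ℕ => c ν * ∏ l, y l ^ ν l := by
  classical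
  apply NonarchimedeanAddGroup.summable_of_tendsto_cofinite_zero
  have hsum : Tendsto (fun ν : ι → ℕ => ∑ l, ν l) cofinite atTop := by
    refine tendsto_atTop.2 fun N => ?_
    rw [eventually_cofinite]
    refine (Set.finite_Iic (fun _ : ι => N)).subset fun ν hν l => ?_
    have := single_le_sum (f := ν) (fun _ _ => Nat.zero_le _) (mem_univ l)
    simp only [Set.mem_ofPred_eq] at hν
    change ν l ≤ N
    omega
  refine squeeze_zero_norm (fun ν => ?_) ((tendsto_pow_atTop_nhds_zero_of_lt_one ht0 ht1).comp hsum)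
  have hprod : ‖∏ l, y l ^ ν l‖ ≤ 1 := by
    rw [norm_prod]
    exact prod_le_one (fun _ _ => norm_nonneg _) fun l _ => by
      rw [norm_pow]; exact pow_le_one₀ (norm_nonneg _) (hy l)
  rw [norm_mul]
  exact (mul_le_of_le_one_right (norm_nonneg _) hprod).trans (hc ν)

/-- Distinct elements of `Fin E × ℕ^d` have large total degree: at most `E * n ^ d` of them have
degree less than `n`. -/
theorem mul_le_sum_degree_of_injective {d E μ : ℕ} (n : ℕ) (φ : Fin μ → Fin E × (Fin d → ℕ))
    (hφ : Function.Injective φ) : n * μ ≤ (∑ i, ∑ l, (φ i).2 l) + n * (E * n ^ d) := by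
  classical
  have hcard : #{i | ∑ l, (φ i).2 l < n} ≤ E * n ^ d := by
    have h := card_le_card_of_injOn (s := {i | ∑ l, (φ i).2 l < n})
      (t := (univ : Finset (Fin E)) ×ˢ Fintype.piFinset fun _ : Fin d => range n) φ
      (fun i hi => by
        simp only [coe_filter, mem_univ, true_and, Set.mem_ofPred_eq] at hi
        simp only [coe_product, Set.mem_prod, mem_coe, mem_univ, true_and, Fintype.mem_piFinset,
          mem_range]
        exact fun l => (single_le_sum (f := (φ i).2) (fun _ _ => Nat.zero_le _)
          (mem_univ l)).trans_lt hi) hφ.injOn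
    simpa using h
  have hsum : ∑ _i : Fin μ, n ≤
      ∑ i, ((∑ l, (φ i).2 l) + if ∑ l, (φ i).2 l < n then n else 0) :=
    sum_le_sum fun i _ => by split_ifs <;> omega
  rw [sum_add_distrib, ← sum_filter] at hsum
  simp only [sum_const, card_univ, Fintype.card_fin, smul_eq_mul] at hsum
  nlinarith

theorem rpow_le_sum_degree_of_injective {d E μ : ℕ} (hd : 1 ≤ d) (hE : 1 ≤ E) (hμ : 2 * E ≤ μ)
    (φ : Fin μ → Fin E × (Fin d → ℕ)) (hφ : Function.Injective φ) :
    1 / 8 * (E : ℝ) ^ (-(1 / (d : ℝ))) * (μ : ℝ) ^ (1 + 1 / (d : ℝ)) ≤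
      ((∑ i, ∑ l, (φ i).2 l : ℕ) : ℝ) := by
  have hE' : (0 : ℝ) < E := by exact_mod_cast hE
  have hd' : (1 : ℝ) ≤ d := by exact_mod_cast hd
  have hμ' : 2 * (E : ℝ) ≤ μ := by exact_mod_cast hμ
  have hμ0 : (0 : ℝ) < μ := by linarith
  set x : ℝ := μ / (2 * E) with hx
  have hx1 : 1 ≤ x := by rw [hx, le_div_iff₀ (by positivity)]; linarith
  set s : ℝ := x ^ (1 / (d : ℝ)) with hs
  have hs1 : 1 ≤ s := Real.one_le_rpow hx1 (by positivity)
  have hsd : s ^ d = x := by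
    rw [hs, one_div]
    exact Real.rpow_inv_natCast_pow (by linarith) (by omega)
  set n : ℕ := ⌊s⌋₊ with hn
  have hns : (n : ℝ) ≤ s := Nat.floor_le (by linarith)
  have hn1 : (1 : ℝ) ≤ n := by
    exact_mod_cast (Nat.le_floor (by simpa using hs1) : 1 ≤ ⌊s⌋₊)
  have hsn : s ≤ 2 * n := by have := Nat.lt_floor_add_one s; rw [← hn] at this; linarith
  have hnd : (E : ℝ) * n ^ d ≤ μ / 2 := by
    calc (E : ℝ) * n ^ d ≤ E * x := by rw [← hsd]; gcongr
      _ = μ / 2 := by rw [hx]; field_simp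
  have hmain : (n : ℝ) * μ ≤ ((∑ i, ∑ l, (φ i).2 l : ℕ) : ℝ) + n * (E * n ^ d) := by
    exact_mod_cast mul_le_sum_degree_of_injective n φ hφ
  have hlow : s * μ / 4 ≤ ((∑ i, ∑ l, (φ i).2 l : ℕ) : ℝ) := by nlinarith
  refine le_trans ?_ hlow
  have hx2 : (E : ℝ) ^ (-(1 / (d : ℝ))) * (μ : ℝ) ^ (1 / (d : ℝ)) ≤ 2 * s := by
    have h2 : (2 : ℝ) ^ (1 / (d : ℝ)) ≤ 2 := by
      conv_rhs => rw [← Real.rpow_one 2]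
      exact Real.rpow_le_rpow_of_exponent_le (by norm_num) (by rw [div_le_one] <;> linarith)
    have hμx : (μ : ℝ) = E * (2 * x) := by rw [hx]; field_simp
    calc (E : ℝ) ^ (-(1 / (d : ℝ))) * (μ : ℝ) ^ (1 / (d : ℝ))
        = (2 : ℝ) ^ (1 / (d : ℝ)) * s := by
          rw [hμx, Real.mul_rpow hE'.le (by positivity), Real.mul_rpow (by norm_num) (by positivity),
            ← mul_assoc, ← Real.rpow_add hE']
          simp [hs]
      _ ≤ 2 * s := by gcongr
  rw [Real.rpow_add hμ0, Real.rpow_one]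
  nlinarith


/-- **Interpolation determinant bound** (Proposition 4.1).
For every `d ≥ 1` there is a constant `C_d > 0` such that for any complete
nonarchimedean normed field `K`, any `E ≥ 1`, `μ ≥ (d+1)·E`, `0 < ρ₀ < 1`,
points `y⁽ʲ⁾ ∈ K^d` of norm `≤ 1`, weights `w⁽ʲ⁾ ∈ K^E` of norm `≤ 1`, and
coefficients `c_{i,k,ν}` with `‖c_{i,k,ν}‖ ≤ ρ₀^{|ν|}`, the determinant of the
matrix `M_{i,j} = Σ_k (Σ_ν c_{i,k,ν} (y⁽ʲ⁾)^ν) w⁽ʲ⁾_k` satisfies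
`‖det M‖ ≤ ρ^{C_d·E^{-1/d}·μ^{1+1/d}}`, where
`ρ = ρ₀ · max_{j,j',i} ‖y⁽ʲ⁾_i - y⁽ʲ'⁾_i‖`. -/
theorem interpolation_determinant_bound (d : ℕ) (hd : 1 ≤ d) :
    ∃ C : ℝ, 0 < C ∧
      ∀ (K : Type) [NormedField K] [CompleteSpace K] [IsUltrametricDist K],
      ∀ E μ : ℕ, 1 ≤ E → (d + 1) * E ≤ μ →
      ∀ ρ₀ : ℝ, 0 < ρ₀ → ρ₀ < 1 →
      ∀ y : Fin μ → Fin d → K, (∀ j i, ‖y j i‖ ≤ 1) →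
      ∀ w : Fin μ → Fin E → K, (∀ j k, ‖w j k‖ ≤ 1) →
      ∀ c : Fin μ → Fin E → (Fin d → ℕ) → K,
        (∀ i k ν, ‖c i k ν‖ ≤ ρ₀ ^ (∑ l, ν l)) →
      ∀ ρ : ℝ, ρ = ρ₀ * ⨆ j : Fin μ, ⨆ j' : Fin μ, ⨆ i : Fin d, ‖y j i - y j' i‖ →
      ‖(Matrix.of fun i j : Fin μ =>
          ∑ k : Fin E,
            (∑' ν : Fin d → ℕ, c i k ν * ∏ l : Fin d, y j l ^ ν l) * w j k).det‖
        ≤ ρ ^ (C * (E : ℝ) ^ (-(1 / (d : ℝ))) * (μ : ℝ) ^ (1 + 1 / (d : ℝ))) := by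
  refine ⟨1 / 8, by norm_num, ?_⟩
  intro K _ _ _ E μ hE hμ ρ₀ hρ₀ hρ₁ y hy w hw c hc ρ hρ
  have hμE : 2 * E ≤ μ := (Nat.mul_le_mul_right E (by omega)).trans hμ
  have hμ0 : 0 < μ := by omega
  set r : ℝ := ⨆ j : Fin μ, ⨆ j' : Fin μ, ⨆ i : Fin d, ‖y j i - y j' i‖ with hr
  have hr0 : 0 ≤ r :=
    Real.iSup_nonneg fun _ => Real.iSup_nonneg fun _ => Real.iSup_nonneg fun _ => norm_nonneg _
  have hr1 : r ≤ 1 := by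
    refine Real.iSup_le (fun j => Real.iSup_le (fun j' => Real.iSup_le (fun i => ?_)
      zero_le_one) zero_le_one) zero_le_one
    rw [sub_eq_add_neg]
    exact (IsUltrametricDist.norm_add_le_max _ _).trans
      (max_le (hy j i) ((norm_neg _).trans_le (hy j' i)))
  have hdiff : ∀ j j' i, ‖y j i - y j' i‖ ≤ r := fun j j' i =>
    (le_ciSup (Set.finite_range fun i => ‖y j i - y j' i‖).bddAbove i).trans <|
      (le_ciSup (Set.finite_range fun j' => ⨆ i, ‖y j i - y j' i‖).bddAbove j').trans <|
        le_ciSup (Set.finite_range fun j => ⨆ j', ⨆ i, ‖y j i - y j' i‖).bddAbove j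
  have hρ0 : 0 ≤ ρ := by rw [hρ]; positivity
  have hρ1 : ρ ≤ 1 := by rw [hρ]; exact mul_le_one₀ hρ₁.le hr0 hr1
  have htend : Tendsto (fun F : Finset (Fin d → ℕ) =>
      (Matrix.of fun i j : Fin μ =>
        ∑ k : Fin E, (∑ ν ∈ F, c i k ν * ∏ l : Fin d, y j l ^ ν l) * w j k).det) atTop
      (𝓝 (Matrix.of fun i j : Fin μ =>
        ∑ k : Fin E,
          (∑' ν : Fin d → ℕ, c i k ν * ∏ l : Fin d, y j l ^ ν l) * w j k).det) := by
    refine ((continuous_id.matrix_det).tendsto _).comp ?_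
    refine tendsto_pi_nhds.2 fun i => tendsto_pi_nhds.2 fun j => ?_
    simp only [Matrix.of_apply]
    refine tendsto_finsetSum _ fun k _ => Tendsto.mul_const _ ?_
    exact (IsUltrametricDist.summable_mul_prod_pow hρ₀.le hρ₁ (c i k) (hc i k) (y j)
      (hy j)).hasSum
  refine le_of_tendsto htend.norm (Eventually.of_forall fun F => ?_)
  obtain ⟨N, hN⟩ : ∃ N, ∀ ν ∈ F, ∀ l, ν l ≤ N :=
    ⟨F.sup fun ν => ∑ l, ν l, fun ν hν l =>
      (single_le_sum (f := ν) (fun _ _ => Nat.zero_le _) (mem_univ l)).trans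
        (le_sup (f := fun ν : Fin d → ℕ => ∑ l, ν l) hν)⟩
  set a : Fin d → K := y ⟨0, hμ0⟩ with ha
  set G := Fintype.piFinset fun _ : Fin d => range (N + 1)
  set b : Fin μ → Fin E × (Fin d → ℕ) → K := fun i s =>
    ∑ ν ∈ F, c i s.1 ν * ∏ l, (a l ^ (ν l - s.2 l) * ((ν l).choose (s.2 l) : K)) with hb
  set v : Fin E × (Fin d → ℕ) → Fin μ → K := fun s j =>
    (∏ l, (y j l - a l) ^ s.2 l) * w j s.1 with hv
  have hmat : (Matrix.of fun i j : Fin μ =>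
        ∑ k : Fin E, (∑ ν ∈ F, c i k ν * ∏ l : Fin d, y j l ^ ν l) * w j k) =
      Matrix.of fun i j : Fin μ => ∑ s ∈ univ ×ˢ G, b i s * v s j := by
    ext i j
    simp only [Matrix.of_apply]
    rw [sum_product]
    refine sum_congr rfl fun k _ => ?_
    have h := sum_mul_prod_add_pow F N hN (c i k) a (fun l => y j l - a l)
    simp only [add_sub_cancel] at h
    rw [h, sum_mul]
    exact sum_congr rfl fun κ _ => by rw [hb, hv, mul_assoc]
  rw [hmat]
  refine IsUltrametricDist.norm_det_sum_le (univ ×ˢ G) b v (fun s => ρ ^ ∑ l, s.2 l) ?_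
    (by positivity) ?_
  · intro i s j
    have hbs : ‖b i s‖ ≤ ρ₀ ^ ∑ l, s.2 l :=
      IsUltrametricDist.norm_taylor_coeff_le F hρ₀.le hρ₁.le (c i s.1) (hc i s.1) a (hy _) s.2
    have hvs : ‖v s j‖ ≤ r ^ ∑ l, s.2 l := by
      rw [hv, norm_mul, norm_prod, ← prod_pow_eq_pow_sum]
      refine (mul_le_of_le_one_right (prod_nonneg fun _ _ => norm_nonneg _) (hw j s.1)).trans ?_
      refine prod_le_prod (fun _ _ => norm_nonneg _) fun l _ => ?_
      rw [norm_pow]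
      exact pow_le_pow_left₀ (norm_nonneg _) (hdiff _ _ _) _
    rw [norm_mul, hρ, mul_pow]
    exact mul_le_mul hbs hvs (norm_nonneg _) (by positivity)
  · intro φ hφ
    rw [prod_pow_eq_pow_sum, ← Real.rpow_natCast]
    exact Real.rpow_le_rpow_of_exponent_ge' hρ0 hρ1 (by positivity)
      (rpow_le_sum_degree_of_injective hd hE hμE φ hφ)
end

section
/- Let d, D ≥ 1 and H ≥ 1 be integers. Let L(D,d+1) = {ν ∈ ℕ^{d+1} : ν₁+⋯+ν_{d+1} ≤ D} and μ = #L(D,d+1). Let a_{j,i} ∈ ℚ for 1 ≤ j ≤ μ and 1 ≤ i ≤ d+1, and assume H(a_{j,i}) ≤ H for all i,j. Let Δ = det M, where M is the μ×μ matrix with rows indexed by j ∈ {1,…,μ} and columns indexed by ν ∈ L(D,d+1), with entries M_{j,ν} = ∏_{i=1}^{d+1} a_{j,i}^{ν_i}. Then for every prime p, either Δ = 0 or the p-adic norm of Δ satisfies |Δ|_p ≥ ( μ! · H^{(d+2)·D·μ} )^{−1}. -/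
/-- A nonzero integer has `p`-adic norm at least the inverse of its absolute value. -/
theorem inv_abs_le_padicNorm_intCast (p : ℕ) [Fact p.Prime] {n : ℤ} (hn : n ≠ 0) :
    ((|n| : ℤ) : ℚ)⁻¹ ≤ padicNorm p n := by
  have hp : 0 < p := (Fact.out : p.Prime).pos
  have hdvd : ((p ^ padicValInt p n : ℕ) : ℤ) ∣ n := by
    push_cast
    exact padicValInt_dvd n
  have hle : ((p ^ padicValInt p n : ℕ) : ℤ) ≤ |n| :=
    Int.le_of_dvd (abs_pos.mpr hn) ((dvd_abs _ _).mpr hdvd)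
  rw [padicNorm.eq_zpow_of_nonzero (by exact_mod_cast hn), padicValRat.of_int, zpow_neg,
    zpow_natCast]
  exact inv_anti₀ (by positivity) (by exact_mod_cast hle)

/-- If scaling the rows of a rational matrix by integers `c i` yields an integer matrix whose
entries are bounded by `B`, then its determinant is zero or has `p`-adic norm at least
`(n! * B ^ n)⁻¹`. -/
theorem det_eq_zero_or_inv_le_padicNorm_det {n : Type*} [Fintype n] [DecidableEq n]
    (p : ℕ) [Fact p.Prime] (M : Matrix n n ℚ) (c : n → ℤ) (hc : ∀ i, c i ≠ 0)
    (N : Matrix n n ℤ) (hN : ∀ i j, (N i j : ℚ) = c i * M i j) (B : ℤ)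
    (hB : ∀ i j, |N i j| ≤ B) :
    M.det = 0 ∨
      (((Fintype.card n).factorial : ℚ) * (B : ℚ) ^ Fintype.card n)⁻¹ ≤ padicNorm p M.det := by
  have hdet : ((N.det : ℤ) : ℚ) = ((∏ i, c i : ℤ) : ℚ) * M.det := by
    rw [Int.cast_prod, ← Matrix.det_mul_column, Int.cast_det]
    congr 1
    ext i j
    simp [hN]
  refine or_iff_not_imp_left.mpr fun hM => ?_
  have hprod : ((∏ i, c i : ℤ) : ℚ) ≠ 0 := by
    exact_mod_cast Finset.prod_ne_zero_iff.mpr fun i _ => hc i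
  have hN0 : N.det ≠ 0 := by
    intro h
    rw [h, Int.cast_zero] at hdet
    exact mul_ne_zero hprod hM hdet.symm
  have hbound : |N.det| ≤ (Fintype.card n).factorial * B ^ Fintype.card n := by
    simpa using Matrix.det_le (abv := AbsoluteValue.abs) hB
  calc (((Fintype.card n).factorial : ℚ) * (B : ℚ) ^ Fintype.card n)⁻¹
      ≤ ((|N.det| : ℤ) : ℚ)⁻¹ :=
        inv_anti₀ (by exact_mod_cast abs_pos.mpr hN0) (by exact_mod_cast hbound)
    _ ≤ padicNorm p N.det := inv_abs_le_padicNorm_intCast p hN0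
    _ = padicNorm p ((∏ i, c i : ℤ) : ℚ) * padicNorm p M.det := by rw [hdet, padicNorm.mul]
    _ ≤ padicNorm p M.det :=
        mul_le_of_le_one_left (padicNorm.nonneg _) (padicNorm.of_int _)

/-- **Lower bound for nonzero polynomial interpolation determinants, p-adic case**
(Proposition 4.3, mixed characteristic). The monomials of total degree at most
`D` in `d+1` variables are encoded as the finset `L` of functions
`Fin (d+1) → Fin (D+1)` with coordinate sum at most `D`, and `μ = #L`.
Given `μ` rational points `a_j ∈ ℚ^{d+1}` of height at most `H`, the
determinant `Δ` of the matrix of monomials `(a_j)^ν` is either zero or has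
`p`-adic norm at least `(μ! · H^{(d+2)Dμ})⁻¹` for every prime `p`. -/
theorem padic_interpolation_determinant_lower_bound
    (d D H : ℕ) (hd : 1 ≤ d) (hD : 1 ≤ D) (hH : 1 ≤ H)
    (L : Finset (Fin (d + 1) → Fin (D + 1)))
    (hL : ∀ ν : Fin (d + 1) → Fin (D + 1), ν ∈ L ↔ ∑ i, (ν i : ℕ) ≤ D)
    (μ : ℕ) (hμ : μ = L.card)
    (a : L → Fin (d + 1) → ℚ)
    (ha : ∀ (j : L) (i : Fin (d + 1)), max (a j i).num.natAbs (a j i).den ≤ H)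
    (Δ : ℚ)
    (hΔ : Δ = (Matrix.of fun j ν : L =>
      ∏ i : Fin (d + 1), a j i ^ ((ν : Fin (d + 1) → Fin (D + 1)) i : ℕ)).det)
    (p : ℕ) (hp : p.Prime) :
    Δ = 0 ∨ ((μ.factorial : ℚ) * (H : ℚ) ^ ((d + 2) * D * μ))⁻¹ ≤ padicNorm p Δ := by
  have : Fact p.Prime := ⟨hp⟩
  have hH' : (1 : ℚ) ≤ H := by exact_mod_cast hH
  have key := det_eq_zero_or_inv_le_padicNorm_det p
    (Matrix.of fun j ν : L =>
      ∏ i : Fin (d + 1), a j i ^ ((ν : Fin (d + 1) → Fin (D + 1)) i : ℕ))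
    (fun j => ∏ i, ((a j i).den : ℤ) ^ D)
    (fun j => Finset.prod_ne_zero_iff.mpr fun i _ =>
      pow_ne_zero _ (by exact_mod_cast (a j i).den_nz))
    (Matrix.of fun j ν : L => ∏ i : Fin (d + 1),
      ((a j i).num ^ (ν.1 i : ℕ) * ((a j i).den : ℤ) ^ (D - (ν.1 i : ℕ))))
    (fun j ν => by
      simp only [Matrix.of_apply]
      push_cast
      rw [← Finset.prod_mul_distrib]
      refine Finset.prod_congr rfl fun i _ => ?_
      have hν : (ν.1 i : ℕ) ≤ D := Nat.lt_succ_iff.mp (ν.1 i).isLt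
      rw [← Rat.mul_den_eq_num (a j i), mul_pow, mul_assoc, ← pow_add,
        Nat.add_sub_cancel' hν, mul_comm])
    ((H : ℤ) ^ ((d + 1) * D))
    (fun j ν => by
      simp only [Matrix.of_apply, Finset.abs_prod]
      calc ∏ i : Fin (d + 1), |(a j i).num ^ (ν.1 i : ℕ) * ((a j i).den : ℤ) ^ (D - (ν.1 i : ℕ))|
          ≤ ∏ _i : Fin (d + 1), (H : ℤ) ^ D := by
            refine Finset.prod_le_prod (fun _ _ => abs_nonneg _) fun i _ => ?_
            have hν : (ν.1 i : ℕ) ≤ D := Nat.lt_succ_iff.mp (ν.1 i).isLt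
            have hnum : |(a j i).num| ≤ (H : ℤ) := by
              rw [Int.abs_eq_natAbs]
              exact_mod_cast (le_max_left _ _).trans (ha j i)
            have hden : ((a j i).den : ℤ) ≤ H := by
              exact_mod_cast (le_max_right _ _).trans (ha j i)
            rw [abs_mul, abs_pow, abs_pow, Nat.abs_cast]
            calc |(a j i).num| ^ (ν.1 i : ℕ) * ((a j i).den : ℤ) ^ (D - (ν.1 i : ℕ))
                ≤ (H : ℤ) ^ (ν.1 i : ℕ) * (H : ℤ) ^ (D - (ν.1 i : ℕ)) := by gcongr
              _ = (H : ℤ) ^ D := by rw [← pow_add, Nat.add_sub_cancel' hν]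
        _ = (H : ℤ) ^ ((d + 1) * D) := by
            rw [Finset.prod_const, Finset.card_univ, Fintype.card_fin, ← pow_mul, mul_comm])
  rw [← hΔ, Fintype.card_coe, ← hμ] at key
  refine key.imp_right (le_trans (inv_anti₀ (by positivity) ?_))
  push_cast
  rw [← pow_mul]
  gcongr
  norm_num
end

section
/- Let F be a field and let d, D ≥ 1 and h ≥ 0 be integers. Let L(D,d+1) = {ν ∈ ℕ^{d+1} : ν₁+⋯+ν_{d+1} ≤ D} and μ = #L(D,d+1). Let a_{j,i} ∈ F(t) (the field of rational functions in one variable t over F) for 1 ≤ j ≤ μ and 1 ≤ i ≤ d+1, and assume each a_{j,i} can be written as a quotient of two polynomials in F[t] each of degree at most h. Let Δ = det M, where M is the μ×μ matrix with entries M_{j,ν} = ∏_{i=1}^{d+1} a_{j,i}^{ν_i} for ν ∈ L(D,d+1). If Δ ≠ 0, then the t-adic valuation of Δ is at most (d+2)·D·μ·h; concretely, writing Δ = f/g with f, g ∈ F[t] coprime, the multiplicity of the root t = 0 in f minus the multiplicity of the root t = 0 in g is at most (d+2)·D·μ·h. -/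
open Polynomial in
theorem natDegree_det_le_of_forall_natDegree_le {R n : Type*} [CommRing R] [Fintype n]
    [DecidableEq n] (P : Matrix n n R[X]) (b : ℕ) (hP : ∀ i j, (P i j).natDegree ≤ b) :
    P.det.natDegree ≤ Fintype.card n * b := by
  rw [Matrix.det_apply]
  refine natDegree_sum_le_of_forall_le _ _ fun σ _ => ?_
  refine (natDegree_smul_le _ _).trans ((natDegree_prod_le _ _).trans ?_)
  simpa using Finset.sum_le_card_nsmul Finset.univ _ b fun i _ => hP (σ i) i

/-- If a rational function times a nonzero polynomial is the polynomial `N`, its order of vanishing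
at `x` is at most the degree of `N`. -/
theorem RatFunc.rootMultiplicity_num_sub_denom_le {F : Type*} [Field F] {Δ : RatFunc F}
    (hne : Δ ≠ 0) {G N : Polynomial F} (hG : G ≠ 0)
    (h : algebraMap (Polynomial F) (RatFunc F) N =
      algebraMap (Polynomial F) (RatFunc F) G * Δ) (x : F) :
    (Δ.num.rootMultiplicity x : ℤ) - (Δ.denom.rootMultiplicity x : ℤ) ≤ N.natDegree := by
  have hnum : Δ.num ≠ 0 := RatFunc.num_ne_zero hne
  have hden : Δ.denom ≠ 0 := Δ.denom_ne_zero
  have hcross : N * Δ.denom = G * Δ.num := by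
    apply RatFunc.algebraMap_injective F
    have hden' : algebraMap (Polynomial F) (RatFunc F) Δ.denom ≠ 0 :=
      RatFunc.algebraMap_ne_zero hden
    have hdiv := (div_eq_iff hden').mp (RatFunc.num_div_denom Δ)
    rw [map_mul, map_mul, h, hdiv, mul_assoc]
  have hGn : G * Δ.num ≠ 0 := mul_ne_zero hG hnum
  have hNd : N * Δ.denom ≠ 0 := hcross ▸ hGn
  have hN : N ≠ 0 := left_ne_zero_of_mul hNd
  have hmult := congrArg (Polynomial.rootMultiplicity x) hcross
  rw [Polynomial.rootMultiplicity_mul hNd, Polynomial.rootMultiplicity_mul hGn] at hmult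
  have hdeg : N.rootMultiplicity x ≤ N.natDegree := by
    classical
    rw [← Polynomial.count_roots]
    exact (Multiset.count_le_card _ _).trans (Polynomial.card_roots' N)
  omega


/-- **Lower bound for nonzero polynomial interpolation determinants,
equicharacteristic case** (Proposition 4.3, `F ⊇ 𝔽_q((t))`). The monomials of
total degree at most `D` in `d+1` variables are encoded as the finset `L` of
functions `Fin (d+1) → Fin (D+1)` with coordinate sum at most `D`, and
`μ = #L`. Given `μ` points `a_j ∈ F(t)^{d+1}` whose coordinates are quotients
of polynomials of degree at most `h`, if the determinant `Δ` of the matrix of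
monomials `(a_j)^ν` is nonzero, then its `t`-adic valuation — the multiplicity
of the root `t = 0` in the (coprime) numerator minus that in the denominator —
is at most `(d+2)·D·μ·h`. -/
theorem ratfunc_interpolation_determinant_valuation_bound
    (F : Type) [Field F] (d D h : ℕ) (hd : 1 ≤ d) (hD : 1 ≤ D)
    (L : Finset (Fin (d + 1) → Fin (D + 1)))
    (hL : ∀ ν : Fin (d + 1) → Fin (D + 1), ν ∈ L ↔ ∑ i, (ν i : ℕ) ≤ D)
    (μ : ℕ) (hμ : μ = L.card)
    (a : L → Fin (d + 1) → RatFunc F)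
    (ha : ∀ (j : L) (i : Fin (d + 1)), ∃ f g : Polynomial F, g ≠ 0 ∧
      f.natDegree ≤ h ∧ g.natDegree ≤ h ∧
      a j i = algebraMap (Polynomial F) (RatFunc F) f
            / algebraMap (Polynomial F) (RatFunc F) g)
    (Δ : RatFunc F)
    (hΔ : Δ = (Matrix.of fun j ν : L =>
      ∏ i : Fin (d + 1), a j i ^ ((ν : Fin (d + 1) → Fin (D + 1)) i : ℕ)).det)
    (hne : Δ ≠ 0) :
    (Δ.num.rootMultiplicity 0 : ℤ) - (Δ.denom.rootMultiplicity 0 : ℤ)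
      ≤ ((d + 2) * D * μ * h : ℤ) := by
  choose f g hg0 hf hg ha using ha
  let P : Matrix L L (Polynomial F) := Matrix.of fun j ν =>
    ∏ i, (f j i ^ ((ν : Fin (d + 1) → Fin (D + 1)) i : ℕ) *
      g j i ^ (D - ((ν : Fin (d + 1) → Fin (D + 1)) i : ℕ)))
  let G : L → Polynomial F := fun j => ∏ i, g j i ^ D
  have hG : ∏ j, G j ≠ 0 :=
    Finset.prod_ne_zero_iff.mpr fun j _ =>
      Finset.prod_ne_zero_iff.mpr fun i _ => pow_ne_zero _ (hg0 j i)
  have hdet : algebraMap (Polynomial F) (RatFunc F) P.det =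
      algebraMap (Polynomial F) (RatFunc F) (∏ j, G j) * Δ := by
    rw [hΔ, map_prod, ← Matrix.det_mul_column, RingHom.map_det]
    congr 1
    ext1 j ν
    simp only [P, G, RingHom.mapMatrix_apply, Matrix.map_apply, Matrix.of_apply, map_prod,
      map_mul, map_pow, ← Finset.prod_mul_distrib]
    refine Finset.prod_congr rfl fun i _ => ?_
    have hgi : algebraMap (Polynomial F) (RatFunc F) (g j i) ≠ 0 :=
      RatFunc.algebraMap_ne_zero (hg0 j i)
    have hν : ((ν : Fin (d + 1) → Fin (D + 1)) i : ℕ) ≤ D := by omega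
    rw [ha, div_pow, mul_div_assoc', eq_div_iff (pow_ne_zero _ hgi), mul_assoc, ← pow_add,
      Nat.sub_add_cancel hν, mul_comm]
  have hdeg : P.det.natDegree ≤ Fintype.card L * ((d + 1) * (D * h)) := by
    refine natDegree_det_le_of_forall_natDegree_le P _ fun j ν => ?_
    have hentry : ∀ i, (f j i ^ ((ν : Fin (d + 1) → Fin (D + 1)) i : ℕ) *
        g j i ^ (D - ((ν : Fin (d + 1) → Fin (D + 1)) i : ℕ))).natDegree ≤ D * h := by
      intro i
      have hν : ((ν : Fin (d + 1) → Fin (D + 1)) i : ℕ) ≤ D := by omega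
      refine Polynomial.natDegree_mul_le.trans ((add_le_add
        (Polynomial.natDegree_pow_le_of_le _ (hf j i))
        (Polynomial.natDegree_pow_le_of_le _ (hg j i))).trans ?_)
      rw [← add_mul, Nat.add_sub_cancel' hν]
    simp only [P, Matrix.of_apply]
    refine (Polynomial.natDegree_prod_le _ _).trans ?_
    simpa using Finset.sum_le_card_nsmul Finset.univ _ (D * h) fun i _ => hentry i
  refine (RatFunc.rootMultiplicity_num_sub_denom_le hne hG hdet 0).trans ?_
  have hle : P.det.natDegree ≤ (d + 2) * D * μ * h := by
    rw [Fintype.card_coe, ← hμ] at hdeg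
    calc P.det.natDegree ≤ μ * ((d + 1) * (D * h)) := hdeg
      _ ≤ μ * ((d + 2) * (D * h)) := by gcongr; omega
      _ = (d + 2) * D * μ * h := by ring
  exact_mod_cast hle
end

section
/- Let K be a field, let n > d ≥ 0 be integers, and let D ≥ 1. Suppose that for every subset I ⊆ {1,…,n} with #I = d+1 we are given a nonzero polynomial Q_I ∈ K[X₁,…,X_n] of total degree at most D which involves only the variables X_i for i ∈ I. Let 𝔞 ⊆ K[X₁,…,X_n] be the ideal generated by all the Q_I. Then the Krull dimension of the quotient ring K[X₁,…,X_n]/𝔞 is at most d. -/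
open MvPolynomial Cardinal

/-- An integral extension does not raise the Krull dimension. -/
theorem ringKrullDim_le_of_isIntegral (R S : Type*) [CommRing R] [CommRing S] [Algebra R S]
    [Algebra.IsIntegral R S] : ringKrullDim S ≤ ringKrullDim R :=
  Order.krullDim_le_of_strictMono (PrimeSpectrum.comap (algebraMap R S)) fun I J hIJ ↦ by
    have hIJ' : I.asIdeal < J.asIdeal := hIJ
    obtain ⟨hle, x, hxJ, hxI⟩ := SetLike.lt_iff_le_and_exists.mp hIJ'
    exact Ideal.comap_lt_comap_of_integral_mem_sdiff hle ⟨hxJ, hxI⟩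
      (Algebra.IsIntegral.isIntegral x)

/-- The Krull dimension of a finitely generated algebra over a field is bounded by any bound on the
transcendence degrees of its quotients by prime ideals. -/
theorem ringKrullDim_le_of_forall_trdeg_quotient_le (K A : Type*) [Field K] [CommRing A]
    [Algebra K A] [Algebra.FiniteType K A] (d : ℕ)
    (h : ∀ p : Ideal A, p.IsPrime → Algebra.trdeg K (A ⧸ p) ≤ d) : ringKrullDim A ≤ d := by
  nontriviality A
  obtain ⟨s, g, hg, hint⟩ := exists_integral_inj_algHom_of_fg K A
  algebraize [g.toRingHom]
  have hker : RingHom.ker (algebraMap (MvPolynomial (Fin s) K) A) ≤ ⊥ :=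
    ((RingHom.injective_iff_ker_eq_bot _).mp hg).le
  obtain ⟨p, -, hp, hcomap⟩ := Ideal.exists_ideal_over_prime_of_isIntegral
    (⊥ : Ideal (MvPolynomial (Fin s) K)) (⊥ : Ideal A) hker
  have hinj : Function.Injective ((Ideal.Quotient.mkₐ K p).comp g) := by
    refine (injective_iff_map_eq_zero _).mpr fun q hq ↦ ?_
    have hq' : q ∈ p.comap (algebraMap (MvPolynomial (Fin s) K) A) :=
      Ideal.Quotient.eq_zero_iff_mem (I := p).mp hq
    simpa [hcomap] using hq'
  have hle := (lift_trdeg_le_of_injective _ hinj).trans (lift_le.mpr (h p hp))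
  have hsd : s ≤ d := by simpa using hle
  calc ringKrullDim A ≤ ringKrullDim (MvPolynomial (Fin s) K) := ringKrullDim_le_of_isIntegral _ _
    _ = s := by simp [MvPolynomial.ringKrullDim_of_isNoetherianRing]
    _ ≤ d := by exact_mod_cast hsd

/-- If a domain is generated by finitely many elements such that any `d + 1` of them satisfy a
nontrivial algebraic relation, then its transcendence degree is at most `d`. -/
theorem trdeg_le_of_forall_exists_relation {K B ι : Type*} [Field K] [CommRing B] [IsDomain B]
    [Algebra K B] [Finite ι] (d : ℕ) (φ : MvPolynomial ι K →ₐ[K] B)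
    (hφ : Function.Surjective φ)
    (h : ∀ I : Finset ι, I.card = d + 1 → ∃ q ∈ supported K (I : Set ι), q ≠ 0 ∧ φ q = 0) :
    Algebra.trdeg K B ≤ d := by
  obtain ⟨x, rfl⟩ : ∃ x : ι → B, φ = aeval x := ⟨_, aeval_unique φ⟩
  have htop : Algebra.adjoin K (Set.range x) = ⊤ := by
    rw [Algebra.adjoin_range_eq_range_aeval, AlgHom.range_eq_top]
    exact hφ
  have : Algebra.IsAlgebraic (Algebra.adjoin K (Set.range x)) B :=
    ⟨fun b ↦ isAlgebraic_algebraMap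
      (⟨b, htop ▸ Algebra.mem_top⟩ : Algebra.adjoin K (Set.range x))⟩
  obtain ⟨t, htx, ht⟩ := exists_isTranscendenceBasis_subset (R := K) (Set.range x)
  rw [← ht.cardinalMk_eq_trdeg]
  by_contra! hlt
  have hd : ((d + 1 : ℕ) : Cardinal) ≤ #t := by
    simpa using Order.succ_le_of_lt hlt
  obtain ⟨u, hut, hu⟩ := le_mk_iff_exists_subset.mp hd
  obtain ⟨J, -, hJ⟩ := Set.SurjOn.exists_bijOn_subset (f := x) (s := Set.univ) (t := u)
    (by simpa [Set.SurjOn] using hut.trans htx)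
  have hJcard : (Set.toFinite J).toFinset.card = d + 1 := by
    rw [← Set.ncard_eq_toFinset_card J, ← hJ.injOn.ncard_image, hJ.image_eq, Set.ncard_def,
      Set.encard, ENat.card, hu]
    simp
  obtain ⟨q, hq, hq0, hφq⟩ := h _ hJcard
  rw [Set.Finite.coe_toFinset] at hq
  have hind : AlgebraicIndepOn K x J := by
    rw [AlgebraicIndepOn, algebraicIndependent_image hJ.injOn, hJ.image_eq]
    exact ht.1.mono hut
  exact hq0 (algebraicIndependent_comp_subtype.mp hind q hq hφq)

/-- **Fibers of the universal family of hypersurface intersections have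
dimension at most `d`** (Lemma 4.8). Let `K` be a field, `n > d ≥ 0`, `D ≥ 1`,
and suppose that for every `(d+1)`-element subset `I ⊆ {1,…,n}` we are given a
nonzero polynomial `Q_I` of total degree at most `D` involving only the
variables indexed by `I`. Then the quotient of `K[X₁,…,X_n]` by the ideal
generated by all the `Q_I` has Krull dimension at most `d`. -/
theorem krull_dim_le_of_hypersurfaces
    (K : Type) [Field K] (n d D : ℕ) (hdn : d < n) (hD : 1 ≤ D)
    (Q : {I : Finset (Fin n) // I.card = d + 1} → MvPolynomial (Fin n) K)
    (hQ0 : ∀ I, Q I ≠ 0)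
    (hQdeg : ∀ I, (Q I).totalDegree ≤ D)
    (hQvars : ∀ I, Q I ∈ MvPolynomial.supported K (↑I.1 : Set (Fin n))) :
    ringKrullDim (MvPolynomial (Fin n) K ⧸ Ideal.span (Set.range Q)) ≤ d := by
  refine ringKrullDim_le_of_forall_trdeg_quotient_le K _ d fun p hp ↦ ?_
  refine trdeg_le_of_forall_exists_relation d
    ((Ideal.Quotient.mkₐ K p).comp (Ideal.Quotient.mkₐ K (Ideal.span (Set.range Q))))
    ((Ideal.Quotient.mkₐ_surjective K p).comp (Ideal.Quotient.mkₐ_surjective K _))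
    fun I hI ↦ ⟨Q ⟨I, hI⟩, hQvars ⟨I, hI⟩, hQ0 ⟨I, hI⟩, ?_⟩
  have hmem : Ideal.Quotient.mk (Ideal.span (Set.range Q)) (Q ⟨I, hI⟩) = 0 :=
    Ideal.Quotient.eq_zero_iff_mem.mpr (Ideal.subset_span ⟨_, rfl⟩)
  simp [hmem]
end

section
/- Let n ≥ 1 and M ≥ 2 be integers. For k = 1,…,n set ε_k = M^{−M^{n−k}} (so ε_n = 1/M), and set N = M^{M^{n−1}}. Order ℕ^n by the reversed lexicographical ordering: for ν, μ ∈ ℕ^n, ν < μ if and only if ν ≠ μ and ν_k < μ_k where k = max{i : ν_i ≠ μ_i}. Let ν, μ ∈ ℕ^n with ν < μ in this order, and suppose M^{M−1} > n·|ν| where |ν| = ν₁+⋯+ν_n. Then: (i) Σ_{k=1}^n ε_k ν_k < Σ_{k=1}^n ε_k μ_k; and (ii) N·(Σ_{k=1}^n ε_k μ_k − Σ_{k=1}^n ε_k ν_k) is a positive integer. -/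
/-- If every weight below `k` is smaller than `w k` by a factor `A > ∑ ν i`, then the weighted sum
respects the reversed lexicographical order. -/
theorem sum_mul_lt_sum_mul_of_revlex {ι : Type*} [Fintype ι] [LinearOrder ι] (w ν μ : ι → ℕ)
    (A : ℕ) (k : ι) (hwk : 0 < w k) (hw : ∀ i < k, A * w i ≤ w k) (hk : ν k < μ k)
    (htail : ∀ i, k < i → ν i = μ i) (hA : ∑ i, ν i < A) :
    ∑ i, w i * ν i < ∑ i, w i * μ i := by
  have key : ∀ i ∈ Finset.univ, A * (w i * ν i) + (if i = k then A * w k else 0) ≤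
      w k * ν i + A * (w i * μ i) := by
    intro i _
    rcases lt_trichotomy i k with h | rfl | h
    · rw [if_neg h.ne, ← mul_assoc]
      exact (Nat.mul_le_mul_right _ (hw i h)).trans (Nat.le_add_right _ _)
    · rw [if_pos rfl]
      calc A * (w i * ν i) + A * w i = A * (w i * (ν i + 1)) := by ring
        _ ≤ A * (w i * μ i) := by gcongr; exact hk
        _ ≤ _ := Nat.le_add_left _ _
    · rw [if_neg h.ne', htail i h]
      exact Nat.le_add_left _ _
  have hsum := Finset.sum_le_sum key
  simp only [Finset.sum_add_distrib, ← Finset.mul_sum, Finset.sum_ite_eq', Finset.mem_univ,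
    if_true] at hsum
  have hlt := Nat.mul_lt_mul_of_pos_left hA hwk
  refine Nat.lt_of_mul_lt_mul_left (a := A) ?_
  linarith

theorem pow_mul_pow_sub_le {M a b E : ℕ} (hM : 2 ≤ M) (hab : a < b) (hb : M ^ b ≤ E) :
    M ^ (M - 1) * M ^ (E - M ^ b) ≤ M ^ (E - M ^ a) := by
  rw [← pow_add]
  refine Nat.pow_le_pow_right (by omega) ?_
  have h1 : M ^ a * M ≤ M ^ b := by
    rw [← pow_succ]
    exact Nat.pow_le_pow_right (by omega) hab
  have h2 : 1 ≤ M ^ a := Nat.one_le_pow _ _ (by omega)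
  have h3 : M ^ a + (M - 1) ≤ M ^ a * M := by
    obtain ⟨m, rfl⟩ : ∃ m, M = m + 1 := ⟨M - 1, by omega⟩
    rw [Nat.add_sub_cancel]
    nlinarith
  omega

/-- **The weight vector of the Noether normalization step** (claims (i) and
(ii) in Step 2 of the proof of Proposition 3.3.1). Let `n ≥ 1`, `M ≥ 2`, and
for `k = 1,…,n` (encoded by `i : Fin n`, `i = k - 1`) set
`ε_k = M^{-M^{n-k}}`; set `N = M^{M^{n-1}}`. Suppose `ν < μ` in the reversed
lexicographical order on `ℕ^n` (witnessed by an index `k` with `ν_k < μ_k` and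
`ν_i = μ_i` for all `i > k`), and `M^{M-1} > n·|ν|`. Then
(i) `Σ ε_k ν_k < Σ ε_k μ_k`, and (ii) `N·(Σ ε_k μ_k − Σ ε_k ν_k)` is a
positive integer. -/
theorem weight_vector_respects_revlex
    (n M : ℕ) (hn : 1 ≤ n) (hM : 2 ≤ M)
    (ν μ : Fin n → ℕ) (k : Fin n)
    (hk : ν k < μ k) (htail : ∀ i : Fin n, k < i → ν i = μ i)
    (hbig : n * (∑ i, ν i) < M ^ (M - 1)) :
    (∑ i : Fin n, (1 / (M : ℝ) ^ (M ^ (n - 1 - (i : ℕ)))) * (ν i : ℝ)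
        < ∑ i : Fin n, (1 / (M : ℝ) ^ (M ^ (n - 1 - (i : ℕ)))) * (μ i : ℝ)) ∧
    ∃ c : ℕ, 0 < c ∧
      ((M : ℝ) ^ (M ^ (n - 1))) *
          (∑ i : Fin n, (1 / (M : ℝ) ^ (M ^ (n - 1 - (i : ℕ)))) * (μ i : ℝ)
            - ∑ i : Fin n, (1 / (M : ℝ) ^ (M ^ (n - 1 - (i : ℕ)))) * (ν i : ℝ)) = c := by
  have hM0 : (0 : ℝ) < M := by exact_mod_cast (by omega : 0 < M)
  have he : ∀ i : Fin n, M ^ (n - 1 - (i : ℕ)) ≤ M ^ (n - 1) := fun i =>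
    Nat.pow_le_pow_right (by omega) (Nat.sub_le _ _)
  have hscale : ∀ ρ : Fin n → ℕ, (M : ℝ) ^ (M ^ (n - 1)) *
      ∑ i : Fin n, (1 / (M : ℝ) ^ (M ^ (n - 1 - (i : ℕ)))) * (ρ i : ℝ) =
      ((∑ i : Fin n, M ^ (M ^ (n - 1) - M ^ (n - 1 - (i : ℕ))) * ρ i : ℕ) : ℝ) := by
    intro ρ
    push_cast
    rw [Finset.mul_sum]
    refine Finset.sum_congr rfl fun i _ => ?_
    rw [pow_sub₀ _ hM0.ne' (he i), one_div, mul_assoc]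
  have hlt := sum_mul_lt_sum_mul_of_revlex
    (fun i : Fin n => M ^ (M ^ (n - 1) - M ^ (n - 1 - (i : ℕ)))) ν μ (M ^ (M - 1)) k
    (Nat.pow_pos (by omega))
    (fun i hi => pow_mul_pow_sub_le hM (by have := k.isLt; have : (i : ℕ) < k := hi; omega) (he i))
    hk htail ((Nat.le_mul_of_pos_left _ hn).trans_lt hbig)
  refine ⟨?_, _, Nat.sub_pos_of_lt hlt, ?_⟩
  · refine lt_of_mul_lt_mul_left ?_ (pow_pos hM0 (M ^ (n - 1))).le
    rw [hscale, hscale]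
    exact_mod_cast hlt
  · rw [mul_sub, hscale, hscale, Nat.cast_sub hlt.le]
end
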